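/- Let M be a set, P₁, P₂ ⊆ M with P₁ infinite and |P₂| ≤ |P₁|, let R : M → M → Prop be any relation, and let F : M → M → M map P₂ × P₂ into P₂ and be an unordered pairing function on P₂ (for all a₁, b₁, a₂, b₂ ∈ P₂, F a₁ b₁ = F a₂ b₂ iff {a₁, b₁} = {a₂, b₂} as sets). Then there exist two distinct ultrafilters D₁ ≠ D₂ on M with P₁ ∈ D₁ and P₁ ∈ D₂ such that for every ultrafilter E on M satisfying (P₂ ∈ E and for every ultrafilter E' with P₂ ∈ E', F̃(E, E') = F̃(E', E)), one has R̃(D₁, E) iff R̃(D₂, E). (This is the semantic content of the fact that the ultrafilter extension of the model M₂ falsifies the sentence ψ.) -/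

import Mathlib

/-- The ultrafilter extension of a binary operation `F : M → M → M`:
`A ∈ ext2 F D₁ D₂` iff `{a | {b | F a b ∈ A} ∈ D₂} ∈ D₁`. -/
def ext2 {M : Type*} (F : M → M → M) (D₁ D₂ : Ultrafilter M) : Ultrafilter M :=
  D₁.bind fun a => Ultrafilter.map (F a) D₂

/-- The ultrafilter extension of a binary relation `R : M → M → Prop`:
`extRel R D₁ D₂` iff `{a | {b | R a b} ∈ D₂} ∈ D₁`. -/
def extRel {M : Type*} (R : M → M → Prop) (D₁ D₂ : Ultrafilter M) : Prop :=
  {a : M | {b : M | R a b} ∈ D₂} ∈ D₁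

open Filter Cardinal

theorem mem_ext2 {M : Type*} {F : M → M → M} {D₁ D₂ : Ultrafilter M} {A : Set M} :
    A ∈ ext2 F D₁ D₂ ↔ {a | {b | F a b ∈ A} ∈ D₂} ∈ D₁ :=
  Iff.rfl

/-- A map moving every point of a well-order strictly up, and injective on a set `S`, alternates
between some set and its complement along `S`. -/
theorem exists_alternating_set {M : Type*} [LinearOrder M] [WellFoundedLT M] {S : Set M}
    {s : M → M} (hlt : ∀ x ∈ S, x < s x) (hinj : Set.InjOn s S) :
    ∃ A : Set M, ∀ x ∈ S, (s x ∈ A ↔ x ∉ A) := by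
  let step : (x : M) → ((y : M) → y < x → Prop) → Prop :=
    fun x C => ∃ (y : M) (h : y < x), y ∈ S ∧ s y = x ∧ ¬ C y h
  let C : M → Prop := (wellFounded_lt (α := M)).fix step
  have hC : ∀ x, C x ↔ ∃ (y : M) (_ : y < x), y ∈ S ∧ s y = x ∧ ¬ C y := fun x =>
    iff_of_eq ((wellFounded_lt (α := M)).fix_eq step x)
  refine ⟨{x | C x}, fun x hx => ?_⟩
  rw [Set.mem_ofPred_eq, hC]
  constructor
  · rintro ⟨y, -, hy, hyx, hn⟩
    rwa [← hinj hy hx hyx]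
  · exact fun h => ⟨x, hlt x hx, hx, rfl, h⟩

/-- Below every set `P` in a nonprincipal ultrafilter there is a large set `S` all of whose elements
have large strict final segments in a given well-order. -/
theorem exists_mem_forall_Ioi_mem {M : Type*} [LinearOrder M] [WellFoundedLT M] {P : Set M}
    {E : Ultrafilter M} (hP : P ∈ E) (hE : ∀ e, E ≠ pure e) :
    ∃ S ∈ E, S ⊆ P ∧ ∀ x ∈ S, {y | x < y} ∈ E := by
  have hsing : ∀ e, {e} ∉ E := fun e he => hE e (Ultrafilter.coe_injective
    (E.neBot.eq_pure_iff.2 he))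
  have key : ∀ x, {y | y < x} ∉ E → {y | x < y} ∈ E := by
    intro x hx
    filter_upwards [Ultrafilter.compl_mem_iff_notMem.2 hx,
      Ultrafilter.compl_mem_iff_notMem.2 (hsing x)] with y h₁ h₂
    exact lt_of_le_of_ne (not_lt.1 h₁) (Ne.symm h₂)
  by_cases h : ∃ a, {y | y < a} ∈ E
  · obtain ⟨a, ha, hmin⟩ := (wellFounded_lt (α := M)).has_min {a | {y | y < a} ∈ E} h
    exact ⟨P ∩ {y | y < a}, inter_mem hP ha, Set.inter_subset_left,
      fun x hx => key x fun hx' => hmin x hx' hx.2⟩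
  · exact ⟨P, hP, subset_rfl, fun x _ => key x fun hx => h ⟨x, hx⟩⟩

/-- An ultrafilter central for the extension of an unordered pairing function is principal. -/
theorem eq_pure_of_ext2_comm {M : Type*} {P : Set M} {F : M → M → M}
    (hF : ∀ a₁ ∈ P, ∀ b₁ ∈ P, ∀ a₂ ∈ P, ∀ b₂ ∈ P,
      (F a₁ b₁ = F a₂ b₂ ↔ ({a₁, b₁} : Set M) = {a₂, b₂}))
    {E : Ultrafilter M} (hP : P ∈ E)
    (hcomm : ∀ E' : Ultrafilter M, P ∈ E' → ext2 F E E' = ext2 F E' E) :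
    ∃ e, E = pure e := by
  by_contra! hE
  obtain ⟨_, _⟩ := exists_wellFoundedLT M
  obtain ⟨S, hSE, hSP, hS⟩ := exists_mem_forall_Ioi_mem hP hE
  have hsucc : ∀ x, ∃ y, x ∈ S → y ∈ S ∧ x < y ∧ ∀ z ∈ S, x < z → y ≤ z := by
    intro x
    by_cases hx : x ∈ S
    · obtain ⟨y, hy, hmin⟩ := (wellFounded_lt (α := M)).has_min (S ∩ {y | x < y})
        (E.nonempty_of_mem (inter_mem hSE (hS x hx)))
      exact ⟨y, fun _ => ⟨hy.1, hy.2, fun z hz hxz => not_lt.1 (hmin z ⟨hz, hxz⟩)⟩⟩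
    · exact ⟨x, fun h => absurd h hx⟩
  choose s hs using hsucc
  have hmono : StrictMonoOn s S := fun x hx y hy hxy =>
    ((hs x hx).2.2 y hy hxy).trans_lt (hs y hy).2.1
  obtain ⟨A, hA⟩ := exists_alternating_set (fun x hx => (hs x hx).2.1) hmono.injOn
  let E' : Ultrafilter M := E.map s
  have hSE' : S ∈ E' := by
    rw [Ultrafilter.mem_map]
    filter_upwards [hSE] with x hx using (hs x hx).1
  have hSlt : ∀ x ∈ S, {y | x < y} ∈ E' := by
    intro x hx
    rw [Ultrafilter.mem_map]
    filter_upwards [hSE, hS x hx] with y hy hxy using lt_trans hxy (hs y hy).2.1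
  have hAE' : ∀ B : Set M, (∀ x ∈ S, x ∈ B → s x ∉ B) → B ∈ E → Bᶜ ∈ E' := by
    intro B hB hBE
    rw [Ultrafilter.mem_map]
    filter_upwards [hSE, hBE] with x hx hxB using hB x hx hxB
  obtain ⟨B, hB, hB'⟩ : ∃ B, B ∈ E ∧ Bᶜ ∈ E' := by
    rcases E.mem_or_compl_mem A with h | h
    · exact ⟨A, h, hAE' A (fun x hx hxA hsA => (hA x hx).1 hsA hxA) h⟩
    · exact ⟨Aᶜ, h, hAE' Aᶜ (fun x hx hxA hsA => hsA ((hA x hx).2 hxA)) h⟩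
  let W : Set M := {c | ∃ a ∈ S, a ∈ B ∧ ∃ b ∈ S, b ∉ B ∧ a < b ∧ F a b = c}
  let W' : Set M := {c | ∃ b ∈ S, b ∉ B ∧ ∃ a ∈ S, a ∈ B ∧ b < a ∧ F b a = c}
  have hW : W ∈ ext2 F E E' := by
    rw [mem_ext2]
    filter_upwards [hSE, hB] with a ha haB
    filter_upwards [hSE', hB', hSlt a ha] with b hb hbB hab
    exact ⟨a, ha, haB, b, hb, hbB, hab, rfl⟩
  have hW' : W' ∈ ext2 F E E' := by
    rw [hcomm E' (mem_of_superset hSE' hSP), mem_ext2]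
    filter_upwards [hSE', hB'] with b hb hbB
    filter_upwards [hSE, hB, hS b hb] with a ha haB hba
    exact ⟨b, hb, hbB, a, ha, haB, hba, rfl⟩
  obtain ⟨c, ⟨a, ha, haB, b, hb, hbB, hab, hc⟩, b', hb', hbB', a', ha', haB', hba, hc'⟩ :=
    (ext2 F E E').nonempty_of_mem (inter_mem hW hW')
  have hpair := (hF a (hSP ha) b (hSP hb) b' (hSP hb') a' (hSP ha')).1 (hc.trans hc'.symm)
  rcases Set.pair_eq_pair_iff.1 hpair with ⟨rfl, rfl⟩ | ⟨rfl, rfl⟩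
  · exact hbB' haB
  · exact lt_asymm hab hba

/-- On an infinite type `α`, given at most `#α` sets `{a | R a i}`, some subset of `α` is not
determined by any finitely many of them. -/
theorem exists_set_not_determined {α ι : Type*} [Infinite α]
    (f : ι ↪ α) (R : α → ι → Prop) :
    ∃ A : Set α, ∀ T : Finset ι, ∃ a ∈ A, ∃ b ∉ A, ∀ i ∈ T, (R a i ↔ R b i) := by
  classical
  by_contra! h
  choose T hT using h
  let code : Set α → Finset ι × Finset (Finset ι) := fun A =>
    (T A, (T A).powerset.filter fun Q => ∃ a ∈ A, (T A).filter (R a) = Q)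
  have hmem : ∀ A a, a ∈ A ↔ (code A).1.filter (R a) ∈ (code A).2 := by
    intro A a
    simp only [code, Finset.mem_filter, Finset.mem_powerset, Finset.filter_subset, true_and]
    refine ⟨fun ha => ⟨a, ha, rfl⟩, fun ⟨b, hb, hba⟩ => ?_⟩
    by_contra ha
    obtain ⟨i, hi, hne⟩ := hT A b hb a ha
    have := Finset.ext_iff.1 hba i
    simp only [Finset.mem_filter, hi, true_and] at this
    tauto
  have hinj : Function.Injective code := fun A B hAB => by
    ext a
    rw [hmem A, hmem B, hAB]
  have hle : #(Set α) ≤ #(Finset α × Finset (Finset α)) :=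
    mk_le_of_injective (f := fun A =>
      ((code A).1.map f, (code A).2.map (Finset.mapEmbedding f).toEmbedding))
      fun A B hAB => hinj (by
        simp only [Prod.mk.injEq, Finset.map_inj] at hAB
        exact Prod.ext hAB.1 hAB.2)
  rw [mk_prod, lift_id, lift_id, mk_finset_of_infinite, mk_finset_of_infinite,
    mk_finset_of_infinite, mul_eq_self (aleph0_le_mk α), mk_set] at hle
  exact (cantor #α).not_ge hle

/-- On an infinite type `α`, no family of at most `#α` sets separates ultrafilters. -/
theorem exists_ne_ultrafilter_forall_mem_iff {α ι : Type*} [Infinite α]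
    (f : ι ↪ α) (R : α → ι → Prop) :
    ∃ D₁ D₂ : Ultrafilter α, D₁ ≠ D₂ ∧ ∀ i, ({a | R a i} ∈ D₁ ↔ {a | R a i} ∈ D₂) := by
  obtain ⟨A, hA⟩ := exists_set_not_determined f R
  choose a ha b hb hab using hA
  let U : Ultrafilter (Finset ι) := Ultrafilter.of atTop
  refine ⟨U.map a, U.map b, fun h => ?_, fun i => ?_⟩
  · have h₁ : A ∈ U.map a := Ultrafilter.mem_map.2 (univ_mem' ha)
    have h₂ : Aᶜ ∈ U.map b := Ultrafilter.mem_map.2 (univ_mem' hb)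
    rw [← h] at h₂
    exact Ultrafilter.compl_notMem_iff.2 h₁ h₂
  · have hi : ∀ᶠ T in (U : Filter (Finset ι)), R (a T) i ↔ R (b T) i :=
      (Ultrafilter.of_le atTop) ((eventually_ge_atTop {i}).mono fun T hT =>
        hab T i (Finset.singleton_subset_iff.1 hT))
    exact eventually_congr hi

/-- Semantic content of `β(M₂) ⊨ ¬ψ`: if `P₁` is infinite with `|P₂| ≤ |P₁|`, and `F`
maps `P₂ × P₂` into `P₂` and is an unordered pairing function on `P₂`, then there are two
distinct ultrafilters concentrated on `P₁` that cannot be separated (via `R̃`) by any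
ultrafilter which is central with respect to `F̃` among ultrafilters concentrated
on `P₂`. -/
theorem ultrafilter_extension_falsifies_psi {M : Type*} (P₁ P₂ : Set M)
    (h₁ : P₁.Infinite) (hcard : Cardinal.mk P₂ ≤ Cardinal.mk P₁)
    (R : M → M → Prop) (F : M → M → M)
    (hmap : ∀ a ∈ P₂, ∀ b ∈ P₂, F a b ∈ P₂)
    (hF : ∀ a₁ ∈ P₂, ∀ b₁ ∈ P₂, ∀ a₂ ∈ P₂, ∀ b₂ ∈ P₂,
      (F a₁ b₁ = F a₂ b₂ ↔ ({a₁, b₁} : Set M) = {a₂, b₂})) :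
    ∃ D₁ D₂ : Ultrafilter M, D₁ ≠ D₂ ∧ P₁ ∈ D₁ ∧ P₁ ∈ D₂ ∧
      ∀ E : Ultrafilter M,
        (P₂ ∈ E ∧ ∀ E' : Ultrafilter M, P₂ ∈ E' → ext2 F E E' = ext2 F E' E) →
        (extRel R D₁ E ↔ extRel R D₂ E) := by
  have : Infinite P₁ := h₁.to_subtype
  obtain ⟨f⟩ := hcard
  obtain ⟨D₁, D₂, hne, hD⟩ := exists_ne_ultrafilter_forall_mem_iff f
    fun (a : P₁) (e : P₂) => R a e
  have hP : ∀ D : Ultrafilter P₁, P₁ ∈ D.map Subtype.val := fun D =>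
    Ultrafilter.mem_map.2 (Filter.univ_mem' fun a => a.2)
  refine ⟨D₁.map Subtype.val, D₂.map Subtype.val, fun h => hne ?_, hP D₁, hP D₂, ?_⟩
  · exact Ultrafilter.coe_injective
      (Filter.map_injective Subtype.val_injective (congrArg Ultrafilter.toFilter h))
  · rintro E ⟨hE, hcomm⟩
    obtain ⟨e, rfl⟩ := eq_pure_of_ext2_comm hF hE hcomm
    exact hD ⟨e, hE⟩
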